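/- In the quotient ring ℚ[x₁,…,x₅]/⟨e₁,…,e₅⟩, where e_k = x₁^k + ⋯ + x₅^k, one has (4x₁ + x₂ + x₃ − 3x₄ − 3x₅)⁸ = 526848 · (x₁−x₂)(x₁−x₃)(x₁−x₄)(x₁−x₅)(x₂−x₄)(x₂−x₅)(x₃−x₄)(x₃−x₅). -/

import Mathlib

open MvPolynomial

/-- The ideal `⟨e₁,…,e₅⟩` of power sums in `ℚ[x₁,…,x₅]`. -/
noncomputable def powerSumIdeal5 : Ideal (MvPolynomial (Fin 5) ℚ) :=
  Ideal.span (Set.range fun k : Fin 5 => ∑ i, X i ^ (k.val + 1))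

/-- A ring containing `ℚ` has no `n`-torsion for `n ≠ 0`. -/
theorem eq_zero_of_natCast_mul_eq_zero {R : Type*} [CommRing R] [Algebra ℚ R] (n : ℕ)
    (hn : n ≠ 0) {x : R} (h : (n : R) * x = 0) : x = 0 := by
  have hu : IsUnit ((n : ℚ)) := (Nat.cast_ne_zero.mpr hn).isUnit
  have hn' : IsUnit (n : R) := by simpa using hu.map (algebraMap ℚ R)
  exact hn'.mul_right_eq_zero.mp h

/-- Newton's identities in five variables: over `ℚ`, vanishing power sums force vanishing
elementary symmetric polynomials. The latter are expanded along `{a}`, `{b, c}`, `{d, e}`. -/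
theorem esymm_eq_zero_of_psum_eq_zero {R : Type*} [CommRing R] [Algebra ℚ R] (a b c d e : R)
    (h1 : a + b + c + d + e = 0)
    (h2 : a ^ 2 + b ^ 2 + c ^ 2 + d ^ 2 + e ^ 2 = 0)
    (h3 : a ^ 3 + b ^ 3 + c ^ 3 + d ^ 3 + e ^ 3 = 0)
    (h4 : a ^ 4 + b ^ 4 + c ^ 4 + d ^ 4 + e ^ 4 = 0)
    (h5 : a ^ 5 + b ^ 5 + c ^ 5 + d ^ 5 + e ^ 5 = 0) :
    a * (b + c) + a * (d + e) + (b + c) * (d + e) + b * c + d * e = 0 ∧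
    a * (b + c) * (d + e) + a * (b * c) + a * (d * e) + (b + c) * (d * e)
      + b * c * (d + e) = 0 ∧
    a * (b * c) * (d + e) + a * (b + c) * (d * e) + b * c * (d * e) = 0 ∧
    a * (b * c) * (d * e) = 0 := by
  have e2 : a * (b + c) + a * (d + e) + (b + c) * (d + e) + b * c + d * e = 0 := by
    apply eq_zero_of_natCast_mul_eq_zero 2 (by norm_num)
    push_cast
    linear_combination (a + b + c + d + e) * h1 - h2
  have e3 : a * (b + c) * (d + e) + a * (b * c) + a * (d * e) + (b + c) * (d * e)
      + b * c * (d + e) = 0 := by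
    apply eq_zero_of_natCast_mul_eq_zero 3 (by norm_num)
    push_cast
    linear_combination (a + b + c + d + e) * e2
      - (a ^ 2 + b ^ 2 + c ^ 2 + d ^ 2 + e ^ 2) * h1 + h3
  have e4 : a * (b * c) * (d + e) + a * (b + c) * (d * e) + b * c * (d * e) = 0 := by
    apply eq_zero_of_natCast_mul_eq_zero 4 (by norm_num)
    push_cast
    linear_combination (a + b + c + d + e) * e3
      - (a ^ 2 + b ^ 2 + c ^ 2 + d ^ 2 + e ^ 2) * e2
      + (a ^ 3 + b ^ 3 + c ^ 3 + d ^ 3 + e ^ 3) * h1 - h4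
  refine ⟨e2, e3, e4, ?_⟩
  apply eq_zero_of_natCast_mul_eq_zero 5 (by norm_num)
  push_cast
  linear_combination (a + b + c + d + e) * e4
    - (a ^ 2 + b ^ 2 + c ^ 2 + d ^ 2 + e ^ 2) * e3
    + (a ^ 3 + b ^ 3 + c ^ 3 + d ^ 3 + e ^ 3) * e2
    - (a ^ 4 + b ^ 4 + c ^ 4 + d ^ 4 + e ^ 4) * h1 + h5

/-- The Chern number identity in terms of the Chern root `a` and the Chern classes `s, p` and `t, q`
of the two rank-two tautological bundles, subject to the Whitney relations. -/
theorem chern_identity_of_whitney {R : Type*} [CommRing R] (a s p t q : R)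
    (h1 : a + s + t = 0)
    (h2 : a * s + a * t + s * t + p + q = 0)
    (h3 : a * s * t + a * p + a * q + s * q + p * t = 0)
    (h4 : a * p * t + a * s * q + p * q = 0)
    (h5 : a * p * q = 0) :
    (4 * a + s - 3 * t) ^ 8 =
      526848 * ((a ^ 2 - s * a + p) * (a ^ 2 - t * a + q) *
        ((p - q) ^ 2 + (s - t) * (s * q - t * p))) := by
  obtain rfl : t = -a - s := by linear_combination h1
  obtain rfl : q = a ^ 2 + a * s + s ^ 2 - p := by linear_combination h2
  linear_combination
    (4184257 * a ^ 5 + 11041504 * a ^ 4 * s + 15817664 * a ^ 3 * s ^ 2 + 10878464 * a ^ 2 * s ^ 3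
      + 2697216 * a * s ^ 4 + 65536 * s ^ 5 - 11052032 * a ^ 3 * p - 9086976 * a ^ 2 * s * p - 4668416 * a * s ^ 2 * p - 1184768 * s ^ 3 * p + 4214784 * a * p ^ 2 +
      1053696 * s * p ^ 2) * h3 +
    (6912831 * a ^ 4 + 7374624 * a ^ 3 * s + 1392704 * a ^ 2 * s ^ 2 - 3542016 * a * s ^ 3
      - 264704 * s ^ 4 - 6355456 * a ^ 2 * p - 2107392 * p ^ 2) * h4 +
    (18924225 * a ^ 3 + 30732000 * a ^ 2 * s + 11966400 * a * s ^ 2 + 5107200 * s ^ 3 +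
      7936000 * a * p) * h5

/-- In `ℚ[x₁,…,x₅]/⟨e₁,…,e₅⟩`, the Chern number identity
`(4x₁+x₂+x₃−3x₄−3x₅)⁸ = 526848·(x₁−x₂)(x₁−x₃)(x₁−x₄)(x₁−x₅)(x₂−x₄)(x₂−x₅)(x₃−x₄)(x₃−x₅)`
for the canonical invariant complex structure on `SU(5)/S(U(1)×U(2)×U(2))`. -/
theorem chern_number_F5_122 :
    Ideal.Quotient.mk powerSumIdeal5 ((4 * X 0 + X 1 + X 2 - 3 * X 3 - 3 * X 4) ^ 8) =
      Ideal.Quotient.mk powerSumIdeal5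
        (526848 * ((X 0 - X 1) * (X 0 - X 2) * (X 0 - X 3) * (X 0 - X 4) *
          (X 1 - X 3) * (X 1 - X 4) * (X 2 - X 3) * (X 2 - X 4))) := by
  have hpsum (k : Fin 5) :
      ∑ i, (Ideal.Quotient.mk powerSumIdeal5 (X i)) ^ (k.val + 1) = 0 := by
    have hmem : ∑ i, X i ^ (k.val + 1) ∈ powerSumIdeal5 :=
      Ideal.subset_span (Set.mem_range_self k)
    simpa using Ideal.Quotient.eq_zero_iff_mem.mpr hmem
  have h1 := hpsum 0
  have h2 := hpsum 1
  have h3 := hpsum 2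
  have h4 := hpsum 3
  have h5 := hpsum 4
  simp only [Fin.sum_univ_five, Fin.isValue, Fin.coe_ofNat_eq_mod, Nat.reduceMod,
    Nat.reduceAdd, pow_one] at h1 h2 h3 h4 h5
  simp only [map_pow, map_add, map_sub, map_mul, map_ofNat]
  generalize Ideal.Quotient.mk powerSumIdeal5 (X 0) = a at *
  generalize Ideal.Quotient.mk powerSumIdeal5 (X 1) = b at *
  generalize Ideal.Quotient.mk powerSumIdeal5 (X 2) = c at *
  generalize Ideal.Quotient.mk powerSumIdeal5 (X 3) = d at *
  generalize Ideal.Quotient.mk powerSumIdeal5 (X 4) = e at *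
  obtain ⟨e2, e3, e4, e5⟩ := esymm_eq_zero_of_psum_eq_zero a b c d e h1 h2 h3 h4 h5
  have h := chern_identity_of_whitney a (b + c) (b * c) (d + e) (d * e)
    (by linear_combination h1) e2 e3 e4 e5
  linear_combination h
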